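/- arXiv:2011.01938 — 4 statements merged into one kernel-verified Lean document; each statement's English description precedes it below -/
import Mathlib

section
/- For any real N × d matrix α and any real symmetric N × N matrix M, the spectral norm of the d × d matrix αᵀ M α equals the spectral norm of the N × N matrix √(ααᵀ) M √(ααᵀ), i.e., ‖αᵀ M α‖∞ = ‖√(ααᵀ) M √(ααᵀ)‖∞. -/
open Matrix

/-- The spectral norm (largest singular value) of a matrix. -/
noncomputable def specNorm {𝕜 : Type*} [RCLike 𝕜] {m n : ℕ} (A : Matrix (Fin m) (Fin n) 𝕜) : ℝ :=
  ‖LinearMap.toContinuousLinearMap (Matrix.toEuclideanLin A)‖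

open scoped Matrix.Norms.L2Operator in
lemma specNorm_eq_l2 {m n : ℕ} (A : Matrix (Fin m) (Fin n) ℝ) : specNorm A = ‖A‖ := by
  rw [Matrix.l2_opNorm_def]
  rfl

open scoped Matrix.Norms.L2Operator in
lemma specNorm_transpose {m n : ℕ} (A : Matrix (Fin m) (Fin n) ℝ) :
    specNorm Aᵀ = specNorm A := by
  rw [specNorm_eq_l2, specNorm_eq_l2, ← Matrix.conjTranspose_eq_transpose_of_trivial,
    Matrix.l2_opNorm_conjTranspose]

open scoped Matrix.Norms.L2Operator in
lemma specNorm_mul_transpose_self {m n : ℕ} (A : Matrix (Fin m) (Fin n) ℝ) :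
    specNorm (A * Aᵀ) = specNorm A * specNorm A := by
  rw [← specNorm_transpose A, specNorm_eq_l2, specNorm_eq_l2,
    ← Matrix.l2_opNorm_conjTranspose_mul_self, Matrix.conjTranspose_eq_transpose_of_trivial,
    Matrix.transpose_transpose]

/-- The norm of `X * A` depends on `A` only through `A * Aᵀ`. -/
lemma specNorm_mul_congr {k m n l : ℕ} (X : Matrix (Fin k) (Fin m) ℝ)
    (A : Matrix (Fin m) (Fin n) ℝ) (B : Matrix (Fin m) (Fin l) ℝ) (h : A * Aᵀ = B * Bᵀ) :
    specNorm (X * A) = specNorm (X * B) := by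
  have key : specNorm (X * A) * specNorm (X * A) = specNorm (X * B) * specNorm (X * B) := by
    rw [← specNorm_mul_transpose_self, ← specNorm_mul_transpose_self]
    congr 1
    rw [Matrix.transpose_mul, Matrix.transpose_mul, Matrix.mul_assoc, Matrix.mul_assoc,
      ← Matrix.mul_assoc A, ← Matrix.mul_assoc B, h]
  exact (mul_self_inj (norm_nonneg _) (norm_nonneg _)).1 key

/-- For any real `N × d` matrix `α` and real symmetric `N × N` matrix `M`,
`‖αᵀ M α‖∞ = ‖√(ααᵀ) M √(ααᵀ)‖∞`, where `S` is the unique symmetric positive semidefinite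
square root of `ααᵀ`. -/
theorem stmt6 (N d : ℕ) (α : Matrix (Fin N) (Fin d) ℝ) (M : Matrix (Fin N) (Fin N) ℝ)
    (hM : M.IsHermitian)
    (S : Matrix (Fin N) (Fin N) ℝ) (hS : S.PosSemidef) (hSS : S * S = α * αᵀ) :
    specNorm (αᵀ * M * α) = specNorm (S * M * S) := by
  have hT : Sᵀ = S := by
    rw [← Matrix.conjTranspose_eq_transpose_of_trivial]
    exact hS.isHermitian
  have h : α * αᵀ = S * Sᵀ := by rw [hT, hSS]
  rw [specNorm_mul_congr (αᵀ * M) α S h, ← specNorm_transpose (αᵀ * M * S),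
    ← specNorm_transpose (S * M * S)]
  simp only [Matrix.transpose_mul, Matrix.transpose_transpose, hT, ← Matrix.mul_assoc]
  exact specNorm_mul_congr (S * Mᵀ) α S h
end

section
/- Let ψ_1, …, ψ_N be unit vectors in ℂ^m, let ρ_i = ψ_i ψ_i† be the corresponding pure-state density matrices, and suppose the real N × N Gram matrix K with entries K_{ij} = Tr(ρ_i ρ_j) = |⟨ψ_i, ψ_j⟩|² is invertible. Then for every Hermitian m × m complex matrix O, ∑_{i=1}^N ∑_{j=1}^N (K^{−1})_{ij} Tr(O ρ_i) Tr(O ρ_j) ≤ N · ‖O‖∞². In particular, if ‖O‖∞ ≤ 1, the model complexity of the quantum kernel method is at most the dimension N of the training-set state space. -/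
open Matrix

theorem aux_abs {E : Type*} [NormedAddCommGroup E] [InnerProductSpace ℂ E] {N : ℕ}
    (v : Fin N → E) (T : E →L[ℂ] E) (c : Fin N → ℝ)
    (h : ∑ i, ∑ j, ((c i : ℂ) * c j) * (inner ℂ (v i) (v j) * inner ℂ (v j) (v i))
      = ((∑ i, c i * (inner ℂ (v i) (T (v i))).re : ℝ) : ℂ)) :
    ∑ i, c i * (inner ℂ (v i) (T (v i))).re ≤ N * ‖T‖ ^ 2 := by
  set S := ∑ i, c i * (inner ℂ (v i) (T (v i))).re with hS
  let W := Submodule.span ℂ (Set.range v)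
  haveI : FiniteDimensional ℂ W := FiniteDimensional.span_of_finite ℂ (Set.finite_range v)
  let b := stdOrthonormalBasis ℂ W
  have hr : Module.finrank ℂ W ≤ N := by
    simpa using (show Module.finrank ℂ W ≤ Fintype.card (Fin N) from finrank_range_le_card (R := ℂ) v)
  set r := Module.finrank ℂ W
  let w : Fin N → W := fun i => ⟨v i, Submodule.subset_span ⟨i, rfl⟩⟩
  let M : Fin r → E := fun k => ∑ i, ((c i : ℂ) * inner ℂ (v i) (b k : E)) • v i
  have hv : ∀ i, v i = ∑ k, inner ℂ (b k : E) (v i) • (b k : E) := by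
    intro i
    have := congrArg (Subtype.val) (b.sum_repr' (w i))
    simpa [w] using this.symm
  have h1 : ∑ k, inner ℂ (M k) (T (b k)) = ∑ i, (c i : ℂ) * inner ℂ (v i) (T (v i)) := by
    have : ∀ i, inner ℂ (v i) (T (v i))
        = ∑ k, inner ℂ (b k : E) (v i) * inner ℂ (v i) (T (b k)) := by
      intro i
      have hT : T (v i) = ∑ k, inner ℂ (b k : E) (v i) • T (b k : E) := by
        conv_lhs => rw [hv i]
        simp only [map_sum, map_smul]
      rw [hT, inner_sum]
      simp only [inner_smul_right]
    simp only [this, M, sum_inner, inner_smul_left, Finset.mul_sum, map_mul, inner_conj_symm,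
      Complex.conj_ofReal]
    rw [Finset.sum_comm]
    simp only [mul_assoc]
  have h2 : ((∑ k, ‖M k‖ ^ 2 : ℝ) : ℂ) = S := by
    rw [← h]
    have hk : ∀ k, ((‖M k‖ ^ 2 : ℝ) : ℂ) = inner ℂ (M k) (M k) := by
      intro k
      rw [inner_self_eq_norm_sq_to_K]; simp
    have hb : ∀ i j, inner ℂ (v j) (v i) = ∑ k, inner ℂ (v j) (b k : E) * inner ℂ (b k : E) (v i) := by
      intro i j
      exact (b.sum_inner_mul_inner (w j) (w i)).symm
    rw [Complex.ofReal_sum]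
    simp only [hk]
    simp only [M, sum_inner, inner_sum, inner_smul_left, inner_smul_right, map_mul,
      inner_conj_symm, Complex.conj_ofReal]
    rw [Finset.sum_comm]
    refine Finset.sum_congr rfl fun i _ => ?_
    simp only [Finset.mul_sum]
    rw [Finset.sum_comm]
    refine Finset.sum_congr rfl fun j _ => ?_
    rw [hb j i, Finset.sum_mul, Finset.mul_sum]
    refine Finset.sum_congr rfl fun k _ => ?_
    ring
  have h2' : ∑ k, ‖M k‖ ^ 2 = S := by exact_mod_cast h2
  have hS0 : 0 ≤ S := h2' ▸ Finset.sum_nonneg fun k _ => by positivity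
  have h3 : S ≤ ‖T‖ * ∑ k, ‖M k‖ := by
    have : S = (∑ k, inner ℂ (M k) (T (b k))).re := by
      rw [h1, Complex.re_sum]; simp [hS]
    rw [this]
    refine (Complex.re_le_norm _).trans ((norm_sum_le _ _).trans ?_)
    rw [Finset.mul_sum]
    refine Finset.sum_le_sum fun k _ => ?_
    refine (norm_inner_le_norm _ _).trans ?_
    have hT := T.le_opNorm (b k : E)
    have hb1 : ‖(b k : E)‖ = 1 := b.norm_eq_one k
    rw [hb1, mul_one] at hT
    rw [mul_comm]
    gcongr
  have h4 : (∑ k, ‖M k‖) ^ 2 ≤ r * S := by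
    have := sq_sum_le_card_mul_sum_sq (s := Finset.univ) (f := fun k => ‖M k‖)
    simpa [h2'] using this
  have h5 : S ^ 2 ≤ (N * ‖T‖ ^ 2) * S := by
    calc S ^ 2 ≤ (‖T‖ * ∑ k, ‖M k‖) ^ 2 := by gcongr
      _ = ‖T‖ ^ 2 * (∑ k, ‖M k‖) ^ 2 := by ring
      _ ≤ ‖T‖ ^ 2 * (r * S) := by gcongr
      _ ≤ ‖T‖ ^ 2 * (N * S) := by gcongr
      _ = _ := by ring
  rcases hS0.eq_or_lt with h0 | h0
  · rw [← h0]; positivity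
  · rw [sq] at h5
    exact le_of_mul_le_mul_right h5 h0

/-- For pure states `ρᵢ = ψᵢψᵢ†` (unit vectors `ψᵢ ∈ ℂ^m`) with invertible real
Gram matrix `K_{ij} = Tr(ρᵢ ρⱼ)` and any Hermitian `O`,
`∑ᵢⱼ (K⁻¹)ᵢⱼ Tr(O ρᵢ) Tr(O ρⱼ) ≤ N ‖O‖∞²`. -/
theorem stmt8 (N m : ℕ) (ψ : Fin N → (Fin m → ℂ))
    (hψ : ∀ i, star (ψ i) ⬝ᵥ ψ i = 1)
    (ρ : Fin N → Matrix (Fin m) (Fin m) ℂ)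
    (hρ : ∀ i, ρ i = Matrix.vecMulVec (ψ i) (star (ψ i)))
    (K : Matrix (Fin N) (Fin N) ℝ)
    (hK : ∀ i j, (K i j : ℂ) = (ρ i * ρ j).trace)
    (hKinv : IsUnit K.det)
    (O : Matrix (Fin m) (Fin m) ℂ) (hO : O.IsHermitian) :
    ∑ i, ∑ j, K⁻¹ i j * ((O * ρ i).trace).re * ((O * ρ j).trace).re ≤
      N * specNorm O ^ 2 := by
  let v : Fin N → EuclideanSpace ℂ (Fin m) := fun i => WithLp.toLp 2 (ψ i)
  let T := LinearMap.toContinuousLinearMap (Matrix.toEuclideanLin O)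
  have hin : ∀ i j, inner ℂ (v i) (v j) = star (ψ i) ⬝ᵥ ψ j := by
    intro i j
    simp only [v, EuclideanSpace.inner_toLp_toLp]
    rw [dotProduct_comm]
  have ho : ∀ i, inner ℂ (v i) (T (v i)) = (O * ρ i).trace := by
    intro i
    rw [hρ, Matrix.mul_vecMulVec, Matrix.trace_vecMulVec]
    simp [v, T, Matrix.toLpLin_apply, EuclideanSpace.inner_toLp_toLp]
  have hKv : ∀ i j, (K i j : ℂ) = inner ℂ (v i) (v j) * inner ℂ (v j) (v i) := by
    intro i j
    rw [hK, hρ, hρ, Matrix.vecMulVec_mul_vecMulVec, hin, hin, Matrix.trace_vecMulVec]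
    simp [dotProduct_comm]
  set o : Fin N → ℝ := fun i => ((O * ρ i).trace).re with hodef
  let c : Fin N → ℝ := K⁻¹ *ᵥ o
  have hc : K *ᵥ c = o := by
    simp only [c, Matrix.mulVec_mulVec, Matrix.mul_nonsing_inv _ hKinv, Matrix.one_mulVec]
  have key := aux_abs v T c ?_
  · simp only [ho] at key
    refine le_trans (le_of_eq ?_) key
    refine Finset.sum_congr rfl fun i _ => ?_
    simp only [c, Matrix.mulVec, dotProduct, Finset.sum_mul]
    refine Finset.sum_congr rfl fun j _ => ?_
    simp only [hodef]; ring
  · simp only [ho, ← hKv]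
    norm_cast
    refine Finset.sum_congr rfl fun i _ => ?_
    have := congrFun hc i
    simp only [hodef] at this
    rw [← this]
    simp only [Matrix.mulVec, dotProduct, Finset.mul_sum]
    refine Finset.sum_congr rfl fun j _ => ?_
    ring
end

section
/- Let K^C and K^Q be real symmetric positive definite N × N matrices, let g² = ‖√K^Q (K^C)^{−1} √K^Q‖∞, let v be a unit eigenvector of √K^Q (K^C)^{−1} √K^Q with eigenvalue g², and set y = √K^Q v ∈ ℝ^N. Then yᵀ (K^Q)^{−1} y = 1 and yᵀ (K^C)^{−1} y = g². That is, the engineered label vector y satisfies s_Q = 1 and s_C = g² s_Q, saturating the geometric inequality between the two kernel models. -/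
open Matrix

/-- Engineered labels saturating the geometric inequality: with
`g² = ‖√K^Q (K^C)⁻¹ √K^Q‖∞`, `v` a unit eigenvector of `√K^Q (K^C)⁻¹ √K^Q` with eigenvalue
`g²`, and `y = √K^Q v`, one has `s_Q = yᵀ(K^Q)⁻¹y = 1` and `s_C = yᵀ(K^C)⁻¹y = g²`. Here `S`
is the unique symmetric positive semidefinite square root of `K^Q`. -/
theorem stmt10 (N : ℕ) (KC KQ : Matrix (Fin N) (Fin N) ℝ)
    (hC : KC.PosDef) (hQ : KQ.PosDef)
    (S : Matrix (Fin N) (Fin N) ℝ) (hS : S.PosSemidef) (hSS : S * S = KQ)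
    (g2 : ℝ) (hg2 : g2 = specNorm (S * KC⁻¹ * S))
    (v : Fin N → ℝ) (hv : v ⬝ᵥ v = 1)
    (hev : (S * KC⁻¹ * S).mulVec v = g2 • v)
    (y : Fin N → ℝ) (hy : y = S.mulVec v) :
    y ⬝ᵥ (KQ⁻¹).mulVec y = 1 ∧ y ⬝ᵥ (KC⁻¹).mulVec y = g2 := by
  have hT : Sᵀ = S := by
    have h := hS.isHermitian.eq
    rwa [Matrix.conjTranspose_eq_transpose_of_trivial] at h
  have key : ∀ M : Matrix (Fin N) (Fin N) ℝ,
      y ⬝ᵥ M.mulVec y = v ⬝ᵥ (S * M * S).mulVec v := by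
    intro M
    rw [← Matrix.mulVec_mulVec, ← Matrix.mulVec_mulVec, ← hy, Matrix.dotProduct_mulVec v S,
      ← Matrix.mulVec_transpose, hT, ← hy]
  have hdet : IsUnit S.det := by
    have h : KQ.det ≠ 0 := hQ.det_pos.ne'
    rw [← hSS, Matrix.det_mul] at h
    exact (left_ne_zero_of_mul h).isUnit
  constructor
  · rw [key, ← hSS, Matrix.mul_inv_rev, ← Matrix.mul_assoc, Matrix.mul_nonsing_inv _ hdet,
      Matrix.one_mul, Matrix.nonsing_inv_mul _ hdet, Matrix.one_mulVec, hv]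
  · rw [key, hev, dotProduct_smul, hv, smul_eq_mul, mul_one]
end

section
/- There exists a universal constant C > 0 with the following property. Let X be a measurable space with probability measure μ, let n ≥ 1, let ρ : X → (pure-state density matrices on ℂ^{2^n}) be measurable, let O' be a Hermitian 2^n × 2^n complex matrix with ‖O'‖∞ ≤ 1, and set f(x) = Tr(O' ρ(x)) ∈ [−1, 1]. Fix N ≥ 1 and δ ∈ (0, 1), and suppose that for μ^N-almost every sample (x_1, …, x_N) the N × N quantum-kernel Gram matrix K with K_{ij} = Tr(ρ(x_i) ρ(x_j)) is invertible. Given a sample, define the trained quantum kernel model h(x) = clip(∑_{i,j=1}^N Tr(ρ(x_i) ρ(x)) (K^{−1})_{ij} f(x_j)). Then with probability at least 1 − δ over N i.i.d. draws x_1, …, x_N from μ, ∫_X |h(x) − f(x)| dμ(x) ≤ C ( √(min(N, Tr(O'²)) / N) + √(log(1/δ) / N) ). -/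
open Matrix MeasureTheory

universe u

/-- `clip t = min(1, max(−1, t))`. -/
noncomputable def clip (t : ℝ) : ℝ := min 1 (max (-1) t)


lemma integrable_fsup {Y T : Type*} [MeasurableSpace Y] (ν : Measure Y) [Fintype T] [Nonempty T]
    (F : T → Y → ℝ) (hF : ∀ t, Integrable (F t) ν) (hm : ∀ t, Measurable (F t)) :
    Integrable (fun y => ⨆ t, F t y) ν := by
  have h1 : Integrable (fun y => ∑ t, |F t y|) ν :=
    integrable_finsetSum _ fun t _ => (hF t).abs
  refine h1.mono (Measurable.iSup hm).aestronglyMeasurable (Filter.Eventually.of_forall fun y => ?_)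
  have h0 : 0 ≤ ∑ t, |F t y| := Finset.sum_nonneg fun t _ => abs_nonneg _
  have hle : ∀ t, |F t y| ≤ ∑ t, |F t y| := fun t =>
    Finset.single_le_sum (f := fun t => |F t y|) (fun _ _ => abs_nonneg _) (Finset.mem_univ t)
  rw [Real.norm_eq_abs, Real.norm_eq_abs, abs_of_nonneg h0, abs_le]
  constructor
  · obtain ⟨t⟩ := ‹Nonempty T›
    have := le_ciSup (Finite.bddAbove_range fun t => F t y) t
    have := hle t
    have := neg_abs_le (F t y)
    linarith
  · exact ciSup_le fun t => (le_abs_self _).trans (hle t)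

lemma one_step {X T : Type*} [MeasurableSpace X] (μ : Measure X) [IsProbabilityMeasure μ]
    [Fintype T] [Nonempty T] (l a : T → X → ℝ)
    (hlm : ∀ t, Measurable (l t)) (hli : ∀ t, Integrable (l t) μ)
    (ham : ∀ t, Measurable (a t)) (hai : ∀ t, Integrable (a t) μ)
    (hla : ∀ t s x, |l t x - l s x| ≤ |a t x - a s x|) (u : T → ℝ) :
    ∫ x, ⨆ t, (u t + ((∫ y, l t y ∂μ) - l t x)) ∂μ ≤
      ∫ x, ((⨆ t, (u t + 2 * a t x)) + ⨆ t, (u t - 2 * a t x)) / 2 ∂μ := by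
  have bd : ∀ F : T → ℝ, ∀ t, F t ≤ ⨆ t, F t := fun F t => le_ciSup (Finite.bddAbove_range F) t
  have i1 : Integrable (fun x => ⨆ t, (u t + 2 * l t x)) μ :=
    integrable_fsup μ _ (fun t => (integrable_const _).add ((hli t).const_mul 2))
      (fun t => ((hlm t).const_mul 2).const_add _)
  have i2 : Integrable (fun x => ⨆ t, (u t - 2 * l t x)) μ :=
    integrable_fsup μ _ (fun t => (integrable_const _).sub ((hli t).const_mul 2))
      (fun t => ((hlm t).const_mul 2).const_sub _)
  have i3 : Integrable (fun x => ⨆ t, (u t + 2 * a t x)) μ :=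
    integrable_fsup μ _ (fun t => (integrable_const _).add ((hai t).const_mul 2))
      (fun t => ((ham t).const_mul 2).const_add _)
  have i4 : Integrable (fun x => ⨆ t, (u t - 2 * a t x)) μ :=
    integrable_fsup μ _ (fun t => (integrable_const _).sub ((hai t).const_mul 2))
      (fun t => ((ham t).const_mul 2).const_sub _)
  have i0 : Integrable (fun x => ⨆ t, (u t + ((∫ y, l t y ∂μ) - l t x))) μ :=
    integrable_fsup μ _ (fun t => (integrable_const _).add ((integrable_const _).sub (hli t)))
      (fun t => ((hlm t).const_sub _).const_add _)
  calc ∫ x, ⨆ t, (u t + ((∫ y, l t y ∂μ) - l t x)) ∂μ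
      ≤ ∫ x, ((∫ y, ⨆ t, (u t + 2 * l t y) ∂μ) / 2 + (⨆ t, (u t - 2 * l t x)) / 2) ∂μ := by
        refine integral_mono i0 ((integrable_const _).add (i2.div_const 2)) fun x => ?_
        refine ciSup_le fun t => ?_
        have h1 : u t + 2 * ∫ y, l t y ∂μ ≤ ∫ y, ⨆ t, (u t + 2 * l t y) ∂μ := by
          have : u t + 2 * ∫ y, l t y ∂μ = ∫ y, (u t + 2 * l t y) ∂μ := by
            rw [integral_add (integrable_const _) ((hli t).const_mul 2), integral_const_mul]
            simp
          rw [this]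
          exact integral_mono ((integrable_const _).add ((hli t).const_mul 2)) i1
            fun y => bd (fun t => u t + 2 * l t y) t
        have h2 := bd (fun t => u t - 2 * l t x) t
        simp only at h2 ⊢
        linarith
    _ = ∫ x, ((⨆ t, (u t + 2 * l t x)) + ⨆ t, (u t - 2 * l t x)) / 2 ∂μ := by
        rw [integral_add (integrable_const _) (i2.div_const 2), integral_div, integral_div, integral_div]
        have := integral_add i1 i2
        rw [this, integral_const]
        simp
        ring
    _ ≤ _ := by
        refine integral_mono ((i1.add i2).div_const 2) ((i3.add i4).div_const 2) fun x => ?_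
        have : (⨆ t, (u t + 2 * l t x)) ≤ ((⨆ t, (u t + 2 * a t x)) + ⨆ t, (u t - 2 * a t x))
            - ⨆ t, (u t - 2 * l t x) := by
          refine ciSup_le fun t => ?_
          rw [le_sub_comm]
          refine ciSup_le fun s => ?_
          have h := hla t s x
          have h1 := bd (fun t => u t + 2 * a t x) t
          have h2 := bd (fun t => u t + 2 * a t x) s
          have h3 := bd (fun t => u t - 2 * a t x) t
          have h4 := bd (fun t => u t - 2 * a t x) s
          have h5 := le_abs_self (l t x - l s x)
          rcases abs_cases (a t x - a s x) with ⟨h6, _⟩ | ⟨h6, _⟩ <;> linarith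
        linarith

lemma pi_succ {X : Type*} [MeasurableSpace X] (μ : Measure X) [IsProbabilityMeasure μ]
    (N : ℕ) (F : (Fin (N + 1) → X) → ℝ) :
    ∫ xs, F xs ∂(Measure.pi fun _ : Fin (N + 1) => μ) =
      ∫ p : X × (Fin N → X), F (Fin.cons p.1 p.2) ∂(μ.prod (Measure.pi fun _ : Fin N => μ)) := by
  have h := (measurePreserving_piFinSuccAbove (fun _ : Fin (N + 1) => μ) 0).symm
  rw [← h.integral_comp']
  simp [MeasurableEquiv.piFinSuccAbove_symm_apply, Fin.insertNthEquiv]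

lemma measurable_cons {X : Type*} [MeasurableSpace X] (N : ℕ) :
    Measurable fun p : X × (Fin N → X) => (Fin.cons p.1 p.2 : Fin (N + 1) → X) := by
  refine measurable_pi_iff.2 fun i => ?_
  refine Fin.cases ?_ (fun j => ?_) i
  · simpa using measurable_fst
  · simp only [Fin.cons_succ]
    exact (measurable_pi_apply j).comp measurable_snd

lemma hoeff {X : Type*} [MeasurableSpace X] (μ : Measure X) [IsProbabilityMeasure μ]
    (G : X → ℝ) (hG : Measurable G) (c : ℝ) (hc : 0 ≤ c) (h : ∀ x y, |G x - G y| ≤ c) (r : ℝ) :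
    ∫ x, Real.exp (r * G x) ∂μ ≤ Real.exp (r * (∫ x, G x ∂μ) + r ^ 2 * c ^ 2 / 2) := by
  obtain ⟨x0⟩ : Nonempty X := μ.nonempty_of_neZero
  have hs := ProbabilityTheory.hasSubgaussianMGF_of_mem_Icc (μ := μ) (X := G) (a := G x0 - c)
    (b := G x0 + c) hG.aemeasurable (Filter.Eventually.of_forall fun x => by
      have := abs_le.1 (h x x0)
      constructor <;> linarith)
  have h1 := hs.mgf_le r
  rw [ProbabilityTheory.mgf] at h1
  have h2 : ∫ x, Real.exp (r * G x) ∂μ =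
      Real.exp (r * (∫ x, G x ∂μ)) * ∫ x, Real.exp (r * (G x - ∫ x, G x ∂μ)) ∂μ := by
    rw [← integral_const_mul]
    congr 1; ext x; rw [← Real.exp_add]; ring_nf
  rw [h2, Real.exp_add]
  refine mul_le_mul_of_nonneg_left (h1.trans (Real.exp_le_exp.2 (le_of_eq ?_))) (Real.exp_pos _).le
  have : (G x0 + c - (G x0 - c)) = 2 * c := by ring
  rw [this]
  simp [abs_of_nonneg hc]
  ring

lemma mcd {X : Type*} [MeasurableSpace X] (μ : Measure X) [IsProbabilityMeasure μ]
    (c : ℝ) (hc : 0 ≤ c) (r : ℝ) (M : ℝ) (N : ℕ) : ∀ (F : (Fin N → X) → ℝ) (_ : Measurable F)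
    (_ : ∀ xs, |F xs| ≤ M)
    (_ : ∀ xs i y, |F (Function.update xs i y) - F xs| ≤ c),
    ∫ xs, Real.exp (r * F xs) ∂(Measure.pi fun _ : Fin N => μ) ≤
      Real.exp (r * (∫ xs, F xs ∂(Measure.pi fun _ : Fin N => μ)) + r ^ 2 * N * c ^ 2 / 2) := by
  induction N with
  | zero =>
    intro F hF hM hd
    rw [Measure.pi_of_empty (fun _ : Fin 0 => μ)]
    simp
  | succ N ih =>
    intro F hF hM hd
    have hFm : Measurable fun p : X × (Fin N → X) => F (Fin.cons p.1 p.2) :=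
      hF.comp (measurable_cons N)
    have hFi : Integrable (fun p : X × (Fin N → X) => F (Fin.cons p.1 p.2))
        (μ.prod (Measure.pi fun _ : Fin N => μ)) :=
      Integrable.of_bound hFm.aestronglyMeasurable M (Filter.Eventually.of_forall fun p => hM _)
    have hEi : Integrable (fun p : X × (Fin N → X) => Real.exp (r * F (Fin.cons p.1 p.2)))
        (μ.prod (Measure.pi fun _ : Fin N => μ)) := by
      refine Integrable.of_bound (hFm.const_mul r).exp.aestronglyMeasurable (Real.exp (|r| * M))
        (Filter.Eventually.of_forall fun p => ?_)
      rw [Real.norm_eq_abs, abs_of_pos (Real.exp_pos _), Real.exp_le_exp]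
      refine (le_abs_self _).trans ?_
      rw [abs_mul]
      exact mul_le_mul_of_nonneg_left (hM _) (abs_nonneg _)
    have hsec : ∀ xs : Fin N → X, Integrable (fun x => F (Fin.cons x xs)) μ := fun xs =>
      Integrable.of_bound (hFm.comp (measurable_id.prodMk measurable_const)).aestronglyMeasurable M
        (Filter.Eventually.of_forall fun p => hM _)
    set F' : (Fin N → X) → ℝ := fun xs => ∫ x, F (Fin.cons x xs) ∂μ with hF'
    have hF'm : Measurable F' :=
      (StronglyMeasurable.integral_prod_left (f := fun x xs => F (Fin.cons x xs))
        hFm.stronglyMeasurable).measurable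
    have hF'M : ∀ xs, |F' xs| ≤ M := fun xs => by
      have := norm_integral_le_of_norm_le_const (μ := μ) (f := fun x => F (Fin.cons x xs)) (C := M)
        (Filter.Eventually.of_forall fun x => hM _)
      simpa using this
    have hF'd : ∀ xs i y, |F' (Function.update xs i y) - F' xs| ≤ c := fun xs i y => by
      have := norm_integral_le_of_norm_le_const (μ := μ)
        (f := fun x => F (Fin.cons x (Function.update xs i y)) - F (Fin.cons x xs)) (C := c)
        (Filter.Eventually.of_forall fun x => by
          rw [Fin.cons_update]; exact hd _ _ _)
      rw [integral_sub (hsec _) (hsec _)] at this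
      simpa only [probReal_univ, mul_one, Real.norm_eq_abs] using this
    have hih := ih F' hF'm hF'M hF'd
    have e1 : ∫ xs, F xs ∂(Measure.pi fun _ : Fin (N + 1) => μ) =
        ∫ xs, F' xs ∂(Measure.pi fun _ : Fin N => μ) := by
      rw [pi_succ, integral_prod_symm _ hFi]
    rw [pi_succ, integral_prod_symm _ hEi, e1]
    have hE'i : Integrable (fun xs => Real.exp (r * F' xs)) (Measure.pi fun _ : Fin N => μ) := by
      refine Integrable.of_bound (hF'm.const_mul r).exp.aestronglyMeasurable (Real.exp (|r| * M))
        (Filter.Eventually.of_forall fun p => ?_)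
      rw [Real.norm_eq_abs, abs_of_pos (Real.exp_pos _), Real.exp_le_exp]
      refine (le_abs_self _).trans ?_
      rw [abs_mul]
      exact mul_le_mul_of_nonneg_left (hF'M _) (abs_nonneg _)
    calc _ ≤ ∫ xs, Real.exp (r * F' xs) * Real.exp (r ^ 2 * c ^ 2 / 2)
            ∂(Measure.pi fun _ : Fin N => μ) := by
          refine integral_mono hEi.integral_prod_right (hE'i.mul_const _) fun xs => ?_
          simp only
          rw [← Real.exp_add]
          refine hoeff μ (fun x => F (Fin.cons x xs))
            (hFm.comp (measurable_id.prodMk measurable_const)) c hc (fun x y => ?_) r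
          have := hd (Fin.cons y xs) 0 x
          rwa [Fin.update_cons_zero] at this
      _ ≤ _ := by
          rw [integral_mul_const]
          refine (mul_le_mul_of_nonneg_right hih (Real.exp_pos _).le).trans (le_of_eq ?_)
          rw [← Real.exp_add]
          push_cast
          ring_nf

lemma mcd_tail {X : Type*} [MeasurableSpace X] (μ : Measure X) [IsProbabilityMeasure μ]
    (c : ℝ) (hc : 0 < c) (M : ℝ) (N : ℕ) (hN : 1 ≤ N) (F : (Fin N → X) → ℝ) (hF : Measurable F)
    (hM : ∀ xs, |F xs| ≤ M)
    (hd : ∀ xs i y, |F (Function.update xs i y) - F xs| ≤ c) (m : ℝ)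
    (hm : ∫ xs, F xs ∂(Measure.pi fun _ : Fin N => μ) ≤ m)
    (δ : ℝ) (hδ : δ ∈ Set.Ioo (0 : ℝ) 1) :
    ENNReal.ofReal (1 - δ) ≤ (Measure.pi fun _ : Fin N => μ)
      {xs | F xs ≤ m + c * Real.sqrt (2 * N * Real.log (1 / δ))} := by
  set P := Measure.pi fun _ : Fin N => μ
  set s := c * Real.sqrt (2 * N * Real.log (1 / δ)) with hs
  have hL : 0 < Real.log (1 / δ) := Real.log_pos (by rw [lt_div_iff₀ hδ.1]; linarith [hδ.2])
  have hN' : (0 : ℝ) < N := by exact_mod_cast hN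
  have hs0 : 0 < s := by positivity
  set r := s / (N * c ^ 2) with hr
  have hr0 : 0 < r := by positivity
  have hi : Integrable (fun xs => Real.exp (r * F xs)) P := by
    refine Integrable.of_bound (hF.const_mul r).exp.aestronglyMeasurable (Real.exp (|r| * M))
      (Filter.Eventually.of_forall fun p => ?_)
    rw [Real.norm_eq_abs, abs_of_pos (Real.exp_pos _), Real.exp_le_exp]
    refine (le_abs_self _).trans ?_
    rw [abs_mul]
    exact mul_le_mul_of_nonneg_left (hM _) (abs_nonneg _)
  have hch := ProbabilityTheory.measure_ge_le_exp_mul_mgf (μ := P) (X := F) (m + s) hr0.le hi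
  have hb : P.real {xs | m + s ≤ F xs} ≤ δ := by
    refine hch.trans ?_
    rw [ProbabilityTheory.mgf]
    refine (mul_le_mul_of_nonneg_left (mcd μ c hc.le r M N F hF hM hd) (Real.exp_pos _).le).trans ?_
    rw [← Real.exp_add]
    have hδe : δ = Real.exp (-Real.log (1 / δ)) := by
      rw [Real.log_div one_ne_zero hδ.1.ne', Real.log_one, zero_sub, neg_neg, Real.exp_log hδ.1]
    conv_rhs => rw [hδe]
    rw [Real.exp_le_exp]
    have h1 : r * (∫ xs, F xs ∂P) ≤ r * m := mul_le_mul_of_nonneg_left hm hr0.le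
    have h2 : s ^ 2 = c ^ 2 * (2 * N * Real.log (1 / δ)) := by
      rw [hs, mul_pow, Real.sq_sqrt (by positivity)]
    have h3 : r * s = 2 * Real.log (1 / δ) := by
      rw [hr, div_mul_eq_mul_div, ← sq, h2]; field_simp
    have h4 : r ^ 2 * N * c ^ 2 / 2 = Real.log (1 / δ) := by
      rw [hr, div_pow, h2]; field_simp
    rw [h4]
    nlinarith
  have hmeas : MeasurableSet {xs | m + s ≤ F xs} := measurableSet_le measurable_const hF
  have hcompl : P.real {xs | m + s ≤ F xs}ᶜ = 1 - P.real {xs | m + s ≤ F xs} :=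
    probReal_compl_eq_one_sub hmeas
  calc ENNReal.ofReal (1 - δ) ≤ ENNReal.ofReal (P.real {xs | m + s ≤ F xs}ᶜ) :=
        ENNReal.ofReal_le_ofReal (by rw [hcompl]; linarith)
    _ = P {xs | m + s ≤ F xs}ᶜ := by rw [ofReal_measureReal]
    _ ≤ _ := measure_mono fun xs hx => by
        simp only [Set.mem_compl_iff, Set.mem_ofPred_eq, not_le] at hx ⊢
        exact hx.le

lemma rad_step_sqrt {E : Type*} [NormedAddCommGroup E] [InnerProductSpace ℝ E] (v w : E)
    (hw : ‖w‖ ≤ 1) (k : ℝ) (hk : 0 ≤ k) :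
    (Real.sqrt (‖v + (2 : ℝ) • w‖ ^ 2 + k) + Real.sqrt (‖v - (2 : ℝ) • w‖ ^ 2 + k)) / 2 ≤
      Real.sqrt (‖v‖ ^ 2 + (k + 4)) := by
  apply Real.le_sqrt_of_sq_le
  have hp := parallelogram_law_with_norm ℝ v ((2 : ℝ) • w)
  have h2 : ‖(2 : ℝ) • w‖ = 2 * ‖w‖ := by rw [norm_smul]; simp
  rw [h2] at hp
  have ha := Real.sq_sqrt (show 0 ≤ ‖v + (2 : ℝ) • w‖ ^ 2 + k by positivity)
  have hb := Real.sq_sqrt (show 0 ≤ ‖v - (2 : ℝ) • w‖ ^ 2 + k by positivity)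
  have hw2 : ‖w‖ ^ 2 ≤ 1 := by nlinarith [norm_nonneg w]
  nlinarith [sq_nonneg (Real.sqrt (‖v + (2 : ℝ) • w‖ ^ 2 + k) -
    Real.sqrt (‖v - (2 : ℝ) • w‖ ^ 2 + k))]

lemma rad {X T E : Type*} [MeasurableSpace X] (μ : Measure X) [IsProbabilityMeasure μ]
    [Fintype T] [Nonempty T] [NormedAddCommGroup E] [InnerProductSpace ℝ E]
    (τ : T → E) (B : ℝ) (hB : ∀ t, ‖τ t‖ ≤ B) (Φ : X → E) (hΦ : ∀ x, ‖Φ x‖ ≤ 1)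
    (hΦm : ∀ v : E, Measurable fun x => inner ℝ v (Φ x))
    (l : T → X → ℝ) (hlm : ∀ t, Measurable (l t)) (hl : ∀ t x, |l t x| ≤ 2)
    (hla : ∀ t s x, |l t x - l s x| ≤ |inner ℝ (τ t) (Φ x) - inner ℝ (τ s) (Φ x)|) (N : ℕ) :
    ∀ v : E, ∫ xs, ⨆ t, (inner ℝ (τ t) v + ∑ i, ((∫ y, l t y ∂μ) - l t (xs i)))
      ∂(Measure.pi fun _ : Fin N => μ) ≤ B * Real.sqrt (‖v‖ ^ 2 + 4 * N) := by
  have hB0 : 0 ≤ B := (norm_nonneg _).trans (hB (Classical.arbitrary T))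
  have hli : ∀ t, Integrable (l t) μ := fun t =>
    Integrable.of_bound (hlm t).aestronglyMeasurable 2 (Filter.Eventually.of_forall (hl t))
  have hai : ∀ t, Integrable (fun x => inner ℝ (τ t) (Φ x)) μ := fun t =>
    Integrable.of_bound (hΦm _).aestronglyMeasurable B (Filter.Eventually.of_forall fun x => by
      refine (norm_inner_le_norm _ _).trans ?_
      nlinarith [hB t, hΦ x, norm_nonneg (τ t), norm_nonneg (Φ x)])
  induction N with
  | zero =>
    intro v
    rw [Measure.pi_of_empty (fun _ : Fin 0 => μ)]
    simp only [Finset.univ_eq_empty, Finset.sum_empty, add_zero, integral_dirac, Nat.cast_zero,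
      mul_zero, Real.sqrt_sq (norm_nonneg v)]
    refine ciSup_le fun t => (real_inner_le_norm _ _).trans ?_
    exact mul_le_mul_of_nonneg_right (hB t) (norm_nonneg _)
  | succ N ih =>
    intro v
    set P := Measure.pi fun _ : Fin N => μ with hP
    -- the sum over the remaining coordinates
    set S : T → (Fin N → X) → ℝ := fun t xs => ∑ i, ((∫ y, l t y ∂μ) - l t (xs i)) with hS
    have hSm : ∀ t, Measurable (S t) := fun t =>
      Finset.measurable_fun_sum _ fun i _ => ((hlm t).comp (measurable_pi_apply i)).const_sub _
    have hlI : ∀ t, |∫ y, l t y ∂μ| ≤ 2 := fun t => by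
      have := norm_integral_le_of_norm_le_const (μ := μ) (f := l t) (C := 2)
        (Filter.Eventually.of_forall (hl t))
      simpa using this
    have hSi : ∀ t, Integrable (S t) P := fun t => by
      refine Integrable.of_bound (hSm t).aestronglyMeasurable (∑ i : Fin N, (4 : ℝ))
        (Filter.Eventually.of_forall fun xs => ?_)
      refine (norm_sum_le _ _).trans (Finset.sum_le_sum fun i _ => ?_)
      rw [Real.norm_eq_abs]
      have h1 := abs_le.1 (hlI t)
      have h2 := abs_le.1 (hl t (xs i))
      rw [abs_le]
      constructor <;> linarith
    have hSm' : ∀ t, Measurable fun p : X × (Fin N → X) => S t p.2 := fun t =>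
      (hSm t).comp measurable_snd
    have hSi' : ∀ t, Integrable (fun p : X × (Fin N → X) => S t p.2) (μ.prod P) := fun t =>
      (hSi t).comp_snd μ
    have hlm' : ∀ t, Measurable fun p : X × (Fin N → X) => l t p.1 := fun t =>
      (hlm t).comp measurable_fst
    have hli' : ∀ t, Integrable (fun p : X × (Fin N → X) => l t p.1) (μ.prod P) := fun t =>
      (hli t).comp_fst P
    have ham' : ∀ t, Measurable fun p : X × (Fin N → X) => inner ℝ (τ t) (Φ p.1) := fun t =>
      (hΦm _).comp measurable_fst
    have hai' : ∀ t, Integrable (fun p : X × (Fin N → X) => inner ℝ (τ t) (Φ p.1)) (μ.prod P) :=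
      fun t => (hai t).comp_fst P
    have j0 : Integrable (fun p : X × (Fin N → X) => ⨆ t, ((inner ℝ (τ t) v + S t p.2) +
        ((∫ y, l t y ∂μ) - l t p.1))) (μ.prod P) :=
      integrable_fsup _ _ (fun t => ((integrable_const _).add (hSi' t)).add
        ((integrable_const _).sub (hli' t)))
        (fun t => ((hSm' t).const_add _).add ((hlm' t).const_sub _))
    have j1 : Integrable (fun p : X × (Fin N → X) => ⨆ t, ((inner ℝ (τ t) v + S t p.2) +
        2 * inner ℝ (τ t) (Φ p.1))) (μ.prod P) :=
      integrable_fsup _ _ (fun t => ((integrable_const _).add (hSi' t)).add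
        ((hai' t).const_mul 2))
        (fun t => ((hSm' t).const_add _).add ((ham' t).const_mul 2))
    have j2 : Integrable (fun p : X × (Fin N → X) => ⨆ t, ((inner ℝ (τ t) v + S t p.2) -
        2 * inner ℝ (τ t) (Φ p.1))) (μ.prod P) :=
      integrable_fsup _ _ (fun t => ((integrable_const _).add (hSi' t)).sub
        ((hai' t).const_mul 2))
        (fun t => ((hSm' t).const_add _).sub ((ham' t).const_mul 2))
    have j3 := (j1.add j2).div_const 2
    have e0 : ∫ xs, ⨆ t, (inner ℝ (τ t) v + ∑ i, ((∫ y, l t y ∂μ) - l t (xs i)))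
        ∂(Measure.pi fun _ : Fin (N + 1) => μ) =
        ∫ p : X × (Fin N → X), ⨆ t, ((inner ℝ (τ t) v + S t p.2) +
        ((∫ y, l t y ∂μ) - l t p.1)) ∂(μ.prod P) := by
      rw [pi_succ]
      congr 1
      ext p
      congr 1
      ext t
      rw [Fin.sum_univ_succ]
      simp only [Fin.cons_zero, Fin.cons_succ, hS]
      ring
    rw [e0, integral_prod_symm _ j0]
    calc _ ≤ ∫ xs, ∫ x, ((⨆ t, ((inner ℝ (τ t) v + S t xs) + 2 * inner ℝ (τ t) (Φ x))) +
            ⨆ t, ((inner ℝ (τ t) v + S t xs) - 2 * inner ℝ (τ t) (Φ x))) / 2 ∂μ ∂P := by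
          refine integral_mono j0.integral_prod_right j3.integral_prod_right fun xs => ?_
          exact one_step μ l (fun t x => inner ℝ (τ t) (Φ x)) hlm hli (fun t => hΦm _) hai hla
            (fun t => inner ℝ (τ t) v + S t xs)
      _ = ∫ x, ∫ xs, ((⨆ t, ((inner ℝ (τ t) v + S t xs) + 2 * inner ℝ (τ t) (Φ x))) +
            ⨆ t, ((inner ℝ (τ t) v + S t xs) - 2 * inner ℝ (τ t) (Φ x))) / 2 ∂P ∂μ :=
          (integral_integral_swap (f := fun x xs =>
            ((⨆ t, ((inner ℝ (τ t) v + S t xs) + 2 * inner ℝ (τ t) (Φ x))) +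
            ⨆ t, ((inner ℝ (τ t) v + S t xs) - 2 * inner ℝ (τ t) (Φ x))) / 2) j3).symm
      _ ≤ ∫ x, B * Real.sqrt (‖v‖ ^ 2 + 4 * ((N + 1 : ℕ) : ℝ)) ∂μ := by
          refine integral_mono j3.integral_prod_left (integrable_const _) fun x => ?_
          have k1 : Integrable (fun xs => ⨆ t, ((inner ℝ (τ t) v + S t xs) +
              2 * inner ℝ (τ t) (Φ x))) P :=
            integrable_fsup _ _ (fun t => ((integrable_const _).add (hSi t)).add
              (integrable_const _)) (fun t => ((hSm t).const_add _).add_const _)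
          have k2 : Integrable (fun xs => ⨆ t, ((inner ℝ (τ t) v + S t xs) -
              2 * inner ℝ (τ t) (Φ x))) P :=
            integrable_fsup _ _ (fun t => ((integrable_const _).add (hSi t)).sub
              (integrable_const _)) (fun t => ((hSm t).const_add _).sub_const _)
          have i1 := ih (v + (2 : ℝ) • Φ x)
          have i2 := ih (v - (2 : ℝ) • Φ x)
          have e1 : ∀ xs, (⨆ t, ((inner ℝ (τ t) v + S t xs) + 2 * inner ℝ (τ t) (Φ x))) =
              ⨆ t, (inner ℝ (τ t) (v + (2 : ℝ) • Φ x) + S t xs) := fun xs => by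
            congr 1; ext t; rw [inner_add_right, inner_smul_right]; ring
          have e2 : ∀ xs, (⨆ t, ((inner ℝ (τ t) v + S t xs) - 2 * inner ℝ (τ t) (Φ x))) =
              ⨆ t, (inner ℝ (τ t) (v - (2 : ℝ) • Φ x) + S t xs) := fun xs => by
            congr 1; ext t; rw [inner_sub_right, inner_smul_right]; ring
          change ∫ xs, ((⨆ t, ((inner ℝ (τ t) v + S t xs) + 2 * inner ℝ (τ t) (Φ x))) +
            ⨆ t, ((inner ℝ (τ t) v + S t xs) - 2 * inner ℝ (τ t) (Φ x))) / 2 ∂P ≤ _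
          rw [integral_div, integral_add k1 k2]
          simp only [e1, e2]
          have hst := mul_le_mul_of_nonneg_left
            (rad_step_sqrt v (Φ x) (hΦ x) (4 * N) (by positivity)) hB0
          have hN : 4 * ((N + 1 : ℕ) : ℝ) = 4 * N + 4 := by push_cast; ring
          rw [hN]
          simp only [hS]
          change _ ≤ B * Real.sqrt (‖v‖ ^ 2 + (4 * N + 4))
          linarith
      _ = _ := by simp

lemma clip_lip (a b : ℝ) : |clip a - clip b| ≤ |a - b| := by
  unfold clip
  refine (abs_min_sub_min_le_max _ _ _ _).trans ?_
  simp only [sub_self, abs_zero]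
  refine max_le (abs_nonneg _) ((abs_max_sub_max_le_max _ _ _ _).trans ?_)
  simp

lemma clip_mem (a : ℝ) : |clip a| ≤ 1 := by
  unfold clip
  rw [abs_le]
  exact ⟨le_min (by norm_num) (le_max_left _ _), min_le_left _ _⟩

lemma clip_eq (a : ℝ) (h : |a| ≤ 1) : clip a = a := by
  unfold clip
  rw [abs_le] at h
  rw [max_eq_right h.1, min_eq_right h.2]

lemma clip_meas : Measurable clip := by
  unfold clip
  fun_prop

lemma core {X E : Type*} [MeasurableSpace X] (μ : Measure X) [IsProbabilityMeasure μ]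
    [NormedAddCommGroup E] [InnerProductSpace ℝ E] [FiniteDimensional ℝ E]
    (O : E) (Φ : X → E) (hΦ : ∀ x, ‖Φ x‖ ≤ 1)
    (hΦm : ∀ v : E, Measurable fun x => inner ℝ v (Φ x)) (hO : ∀ x, |inner ℝ O (Φ x)| ≤ 1)
    (N : ℕ) (hN : 1 ≤ N) (δ : ℝ) (hδ : δ ∈ Set.Ioo (0 : ℝ) 1) :
    ENNReal.ofReal (1 - δ) ≤ (Measure.pi fun _ : Fin N => μ)
      {xs | ∀ A : E, ‖A‖ ≤ ‖O‖ → (∀ i, inner ℝ A (Φ (xs i)) = inner ℝ O (Φ (xs i))) →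
        ∫ x, |clip (inner ℝ A (Φ x)) - inner ℝ O (Φ x)| ∂μ ≤
          5 * (Real.sqrt (min (N : ℝ) (‖O‖ ^ 2) / N) + Real.sqrt (Real.log (1 / δ) / N))} := by
  have hL : 0 < Real.log (1 / δ) := Real.log_pos (by rw [lt_div_iff₀ hδ.1]; linarith [hδ.2])
  have hN' : (0 : ℝ) < N := by exact_mod_cast hN
  set η := Real.sqrt (Real.log (1 / δ) / N) with hη
  have hη0 : 0 < η := by positivity
  -- the loss functions
  set L : E → X → ℝ := fun A x => |clip (inner ℝ A (Φ x)) - inner ℝ O (Φ x)| with hLdef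
  have hLm : ∀ A, Measurable (L A) := fun A =>
    ((clip_meas.comp (hΦm A)).sub (hΦm O)).abs
  have hL2 : ∀ A x, |L A x| ≤ 2 := fun A x => by
    simp only [hLdef, abs_abs]
    have h1 := abs_le.1 (clip_mem (inner ℝ A (Φ x)))
    have h2 := abs_le.1 (hO x)
    rw [abs_le]; constructor <;> linarith
  have hLi : ∀ A, Integrable (L A) μ := fun A =>
    Integrable.of_bound (hLm A).aestronglyMeasurable 2 (Filter.Eventually.of_forall (hL2 A))
  have hLI : ∀ A, |∫ y, L A y ∂μ| ≤ 2 := fun A => by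
    have := norm_integral_le_of_norm_le_const (μ := μ) (f := L A) (C := 2)
      (Filter.Eventually.of_forall (hL2 A))
    simpa using this
  have hLla : ∀ A A' x, |L A x - L A' x| ≤ |inner ℝ A (Φ x) - inner ℝ A' (Φ x)| :=
    fun A A' x => by
      refine (abs_abs_sub_abs_le_abs_sub _ _).trans ?_
      rw [sub_sub_sub_cancel_right]
      exact clip_lip _ _
  rcases le_total (N : ℝ) (‖O‖ ^ 2) with hcase | hcase
  · -- trivial regime
    have : {xs : Fin N → X | ∀ A : E, ‖A‖ ≤ ‖O‖ →
        (∀ i, inner ℝ A (Φ (xs i)) = inner ℝ O (Φ (xs i))) →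
        ∫ x, |clip (inner ℝ A (Φ x)) - inner ℝ O (Φ x)| ∂μ ≤
          5 * (Real.sqrt (min (N : ℝ) (‖O‖ ^ 2) / N) + η)} = Set.univ := by
      refine Set.eq_univ_of_forall fun xs A _ _ => ?_
      rw [min_eq_left hcase, div_self hN'.ne', Real.sqrt_one]
      have := (abs_le.1 (hLI A)).2
      simp only [hLdef] at this
      linarith
    rw [this, measure_univ]
    exact ENNReal.ofReal_le_one.2 (by linarith [hδ.1])
  · obtain ⟨t, hts, htf, hcov⟩ := (isCompact_closedBall (0 : E) ‖O‖).finite_cover_balls hη0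
    have hnet : ∀ A : E, ‖A‖ ≤ ‖O‖ → ∃ s : t, ‖A - s‖ ≤ η := fun A hA => by
      have := hcov (show A ∈ Metric.closedBall (0 : E) ‖O‖ by simpa using hA)
      simp only [Set.mem_iUnion, Metric.mem_ball, dist_eq_norm, exists_prop] at this
      obtain ⟨s, hs, h⟩ := this
      exact ⟨⟨s, hs⟩, h.le⟩
    have : Fintype t := htf.fintype
    have : Nonempty t := ⟨(hnet 0 (by simp)).choose⟩
    have htB : ∀ s : t, ‖(s : E)‖ ≤ ‖O‖ := fun s => by simpa using hts s.2
    set F : (Fin N → X) → ℝ := fun xs => ⨆ s : t, ∑ i, ((∫ y, L s y ∂μ) - L s (xs i)) with hF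
    have hFle : ∀ xs (s : t), ∑ i, ((∫ y, L s y ∂μ) - L s (xs i)) ≤ F xs := fun xs s =>
      le_ciSup (Finite.bddAbove_range fun s : t => ∑ i, ((∫ y, L s y ∂μ) - L s (xs i))) s
    have hFm : Measurable F := Measurable.iSup fun s =>
      Finset.measurable_fun_sum _ fun i _ => ((hLm s).comp (measurable_pi_apply i)).const_sub _
    have hterm : ∀ (s : t) x, |(∫ y, L s y ∂μ) - L s x| ≤ 4 := fun s x => by
      have h1 := abs_le.1 (hLI s)
      have h2 := abs_le.1 (hL2 s x)
      rw [abs_le]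
      constructor <;> linarith
    have hsum : ∀ (xs : Fin N → X) (s : t), |∑ i, ((∫ y, L s y ∂μ) - L s (xs i))| ≤
        ∑ i : Fin N, (4 : ℝ) := fun xs s =>
      (Finset.abs_sum_le_sum_abs _ _).trans (Finset.sum_le_sum fun i _ => hterm s _)
    have hFb : ∀ xs, |F xs| ≤ ∑ i : Fin N, (4 : ℝ) := fun xs => by
      rw [abs_le]
      constructor
      · exact (abs_le.1 (hsum xs (Classical.arbitrary t))).1.trans (hFle xs _)
      · exact ciSup_le fun s => (abs_le.1 (hsum xs s)).2
    have hone : ∀ (xs : Fin N → X) i y (s : t),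
        |(∑ j, ((∫ y, L s y ∂μ) - L s (Function.update xs i y j))) -
          ∑ j, ((∫ y, L s y ∂μ) - L s (xs j))| ≤ 2 := fun xs i y s => by
      rw [← Finset.sum_sub_distrib, Finset.sum_eq_single i]
      · simp only [Function.update_self]
        have h1 := abs_le.1 (hL2 s y)
        have h2 := abs_le.1 (hL2 s (xs i))
        have h3 : 0 ≤ L s y := abs_nonneg _
        have h4 : 0 ≤ L s (xs i) := abs_nonneg _
        rw [abs_le]
        constructor <;> linarith
      · intro j _ hj
        simp [Function.update_of_ne hj]
      · simp
    have hFd : ∀ xs i y, |F (Function.update xs i y) - F xs| ≤ 2 := fun xs i y => by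
      rw [abs_le]
      constructor
      · have : F xs ≤ F (Function.update xs i y) + 2 := ciSup_le fun s => by
          have h1 := (abs_le.1 (hone xs i y s)).1
          have h2 := hFle (Function.update xs i y) s
          linarith
        linarith
      · have : F (Function.update xs i y) ≤ F xs + 2 := ciSup_le fun s => by
          have h1 := (abs_le.1 (hone xs i y s)).2
          have h2 := hFle xs s
          linarith
        linarith
    have hmean := rad μ (fun s : t => (s : E)) ‖O‖ htB Φ hΦ hΦm (fun s : t => L s)
      (fun s => hLm s) (fun s => hL2 s) (fun s s' x => hLla s s' x) N 0
    simp only [inner_zero_right, zero_add, norm_zero] at hmean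
    have htail := mcd_tail μ 2 (by norm_num) _ N hN F hFm hFb hFd _ hmean δ hδ
    refine htail.trans (measure_mono fun xs hxs A hA hint => ?_)
    have hxs' : F xs ≤ ‖O‖ * Real.sqrt (0 ^ 2 + 4 * N) +
      2 * Real.sqrt (2 * N * Real.log (1 / δ)) := hxs
    obtain ⟨s, hs⟩ := hnet A hA
    have hclose : ∀ x, |L A x - L s x| ≤ η := fun x => by
      refine (hLla A s x).trans ?_
      rw [← inner_sub_left]
      refine (abs_real_inner_le_norm _ _).trans ?_
      nlinarith [hΦ x, norm_nonneg (Φ x), norm_nonneg (A - s)]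
    have hI : ∫ x, L A x ∂μ ≤ (∫ x, L s x ∂μ) + η := by
      have : ∫ x, L A x ∂μ ≤ ∫ x, (L s x + η) ∂μ :=
        integral_mono (hLi A) ((hLi s).add (integrable_const _)) fun x => by
          have := (abs_le.1 (hclose x)).2
          simp only
          linarith
      rw [integral_add (hLi s) (integrable_const _)] at this
      simpa using this
    have hzero : ∀ i, L A (xs i) = 0 := fun i => by
      simp only [hLdef]
      rw [hint i, clip_eq _ (hO _), sub_self, abs_zero]
    have hsi : ∀ i, L s (xs i) ≤ η := fun i => by
      have := (abs_le.1 (hclose (xs i))).1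
      rw [hzero i] at this
      linarith
    have hlow : (N : ℝ) * ((∫ x, L A x ∂μ) - 2 * η) ≤ F xs := by
      refine le_trans ?_ (hFle xs s)
      have : ∑ i : Fin N, ((∫ x, L A x ∂μ) - 2 * η) ≤
          ∑ i, ((∫ y, L s y ∂μ) - L s (xs i)) :=
        Finset.sum_le_sum fun i _ => by
          have := hsi i
          linarith
      rw [Finset.sum_const] at this
      simpa only [Finset.card_univ, Fintype.card_fin, nsmul_eq_mul] using this
    have hb1 : ‖O‖ * Real.sqrt (0 ^ 2 + 4 * N) = N * (2 * Real.sqrt (‖O‖ ^ 2 / N)) := by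
      rw [Real.sqrt_div (sq_nonneg _), Real.sqrt_sq (norm_nonneg _)]
      have h4 : Real.sqrt (0 ^ 2 + 4 * N) = 2 * Real.sqrt N := by
        rw [show (0 : ℝ) ^ 2 + 4 * N = 2 ^ 2 * N by ring, Real.sqrt_mul (by norm_num),
          Real.sqrt_sq (by norm_num)]
      rw [h4]
      have h5 := Real.mul_self_sqrt hN'.le
      have h6 : Real.sqrt N ≠ 0 := by positivity
      field_simp
      rw [sq, h5]
    have hb2 : 2 * Real.sqrt (2 * N * Real.log (1 / δ)) ≤ N * (3 * η) := by
      have h7 : 0 ≤ (N : ℝ) * (3 * η) := by positivity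
      have h8 : Real.sqrt (2 * N * Real.log (1 / δ)) ≤ N * (3 * η) / 2 := by
        apply Real.sqrt_le_iff.2 ⟨by positivity, ?_⟩
        have : η ^ 2 = Real.log (1 / δ) / N := Real.sq_sqrt (by positivity)
        have h9 : (N * (3 * η) / 2) ^ 2 = 9 / 4 * (N * Real.log (1 / δ)) := by
          rw [div_pow, mul_pow, mul_pow, this]; field_simp; ring
        rw [h9]
        nlinarith [mul_pos hN' hL]
      linarith
    rw [min_eq_right hcase]
    have hfin : (N : ℝ) * ((∫ x, L A x ∂μ) - 2 * η) ≤
        N * (2 * Real.sqrt (‖O‖ ^ 2 / N) + 3 * η) := by linarith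
    have := le_of_mul_le_mul_left hfin hN'
    have h0 := Real.sqrt_nonneg (‖O‖ ^ 2 / N)
    change ∫ x, L A x ∂μ ≤ _
    linarith

lemma interp {E : Type*} [NormedAddCommGroup E] [InnerProductSpace ℝ E] {N : ℕ} (O : E)
    (φ : Fin N → E) (K : Matrix (Fin N) (Fin N) ℝ) (hK : ∀ i j, K i j = inner ℝ (φ i) (φ j))
    (hu : IsUnit K.det) (y : Fin N → ℝ) (hy : ∀ i, y i = inner ℝ O (φ i)) (A : E)
    (hA : A = ∑ i, (∑ j, K⁻¹ i j * y j) • φ i) :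
    ‖A‖ ≤ ‖O‖ ∧ ∀ k, inner ℝ A (φ k) = inner ℝ O (φ k) := by
  have hint : ∀ k, inner ℝ A (φ k) = inner ℝ O (φ k) := fun k => by
    have h1 : K *ᵥ (K⁻¹ *ᵥ y) = y := by
      rw [Matrix.mulVec_mulVec, Matrix.mul_nonsing_inv _ hu, Matrix.one_mulVec]
    rw [← hy k, ← congrFun h1 k, hA, sum_inner]
    simp only [Matrix.mulVec, dotProduct]
    refine Finset.sum_congr rfl fun i _ => ?_
    rw [inner_smul_left, hK k i, real_inner_comm]
    simp [mul_comm]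
  refine ⟨?_, hint⟩
  have h2 : inner ℝ A A = inner ℝ O A := by
    have h4 : ∀ Z : E, inner ℝ Z A = ∑ i, (∑ j, K⁻¹ i j * y j) * inner ℝ Z (φ i) := fun Z => by
      conv_lhs => rw [hA]
      rw [inner_sum]
      simp only [inner_smul_right]
    rw [h4 A, h4 O]
    simp only [hint]
  have h3 := real_inner_le_norm O A
  rw [← h2, real_inner_self_eq_norm_sq] at h3
  by_contra! h
  nlinarith [norm_nonneg O, norm_nonneg A]

/-- Real vectorization of a complex matrix. -/
noncomputable def realVec {d : ℕ} (M : Matrix (Fin d) (Fin d) ℂ) :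
    EuclideanSpace ℝ ((Fin d × Fin d) ⊕ (Fin d × Fin d)) :=
  WithLp.toLp 2 (Sum.elim (fun p => (M p.1 p.2).re) (fun p => (M p.1 p.2).im))

lemma inner_realVec {d : ℕ} (A M : Matrix (Fin d) (Fin d) ℂ) (hM : M.IsHermitian) :
    inner ℝ (realVec A) (realVec M) = ((A * M).trace).re := by
  have h : ∀ i j, M j i = star (M i j) := fun i j => (hM.apply j i).symm
  simp only [realVec, PiLp.inner_apply, Fintype.sum_sum_type, Fintype.sum_prod_type,
    Sum.elim_inl, Sum.elim_inr, Matrix.trace, Matrix.diag, Matrix.mul_apply, Complex.re_sum]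
  rw [← Finset.sum_add_distrib]
  refine Finset.sum_congr rfl fun i _ => ?_
  rw [← Finset.sum_add_distrib]
  refine Finset.sum_congr rfl fun j _ => ?_
  rw [h i j]
  simp
  ring

lemma expval_le {d : ℕ} (O' : Matrix (Fin d) (Fin d) ℂ)
    (hO : ‖LinearMap.toContinuousLinearMap (Matrix.toEuclideanLin O')‖ ≤ 1)
    (ψ : Fin d → ℂ) (hψ : star ψ ⬝ᵥ ψ = 1) :
    |((O' * Matrix.vecMulVec ψ (star ψ)).trace).re| ≤ 1 := by
  have h1 : (O' * Matrix.vecMulVec ψ (star ψ)).trace =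
      inner ℂ (WithLp.toLp 2 ψ : EuclideanSpace ℂ (Fin d))
        (LinearMap.toContinuousLinearMap (Matrix.toEuclideanLin O') (WithLp.toLp 2 ψ)) := by
    rw [Matrix.mul_vecMulVec, Matrix.trace_vecMulVec, EuclideanSpace.inner_eq_star_dotProduct]
    rfl
  have h2 : ‖(WithLp.toLp 2 ψ : EuclideanSpace ℂ (Fin d))‖ = 1 := by
    have : inner ℂ (WithLp.toLp 2 ψ : EuclideanSpace ℂ (Fin d)) (WithLp.toLp 2 ψ) = 1 := by
      rw [EuclideanSpace.inner_eq_star_dotProduct, dotProduct_comm]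
      exact hψ
    have h3 := congrArg Complex.re this
    have h4 := inner_self_eq_norm_sq (𝕜 := ℂ) (WithLp.toLp 2 ψ : EuclideanSpace ℂ (Fin d))
    have h5 : ‖(WithLp.toLp 2 ψ : EuclideanSpace ℂ (Fin d))‖ ^ 2 = 1 := by
      rw [← h4]; simpa using h3
    nlinarith [norm_nonneg (WithLp.toLp 2 ψ : EuclideanSpace ℂ (Fin d))]
  rw [h1]
  refine (Complex.abs_re_le_norm _).trans ((norm_inner_le_norm _ _).trans ?_)
  rw [h2, one_mul]
  refine (ContinuousLinearMap.le_opNorm _ _).trans ?_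
  rw [h2, mul_one]
  exact hO

/-- There is a universal constant `C > 0` such that for any pure-state
encoding `ρ : X → (pure states on ℂ^{2^n})`, any Hermitian `O'` with `‖O'‖∞ ≤ 1`, target
`f(x) = Tr(O' ρ(x))`, any `N ≥ 1` and `δ ∈ (0,1)`: if the quantum-kernel Gram matrix is
invertible for `μ^N`-almost every sample, then with probability at least `1 − δ` over `N`
i.i.d. draws from `μ`, the trained quantum kernel model `h` satisfies
`∫ |h − f| dμ ≤ C (√(min(N, Tr(O'²))/N) + √(log(1/δ)/N))`. -/
theorem stmt17 : ∃ C : ℝ, 0 < C ∧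
    ∀ (X : Type u) [MeasurableSpace X] (μ : Measure X) [IsProbabilityMeasure μ]
      (n : ℕ) (_ : 1 ≤ n)
      (ρ : X → Matrix (Fin (2 ^ n)) (Fin (2 ^ n)) ℂ)
      (_ : ∀ i j, Measurable fun x => ρ x i j)
      (_ : ∀ x, ∃ ψ : Fin (2 ^ n) → ℂ, star ψ ⬝ᵥ ψ = 1 ∧
        ρ x = Matrix.vecMulVec ψ (star ψ))
      (O' : Matrix (Fin (2 ^ n)) (Fin (2 ^ n)) ℂ) (_ : O'.IsHermitian)
      (_ : ‖LinearMap.toContinuousLinearMap (Matrix.toEuclideanLin O')‖ ≤ 1)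
      (f : X → ℝ) (_ : ∀ x, f x = ((O' * ρ x).trace).re)
      (N : ℕ) (_ : 1 ≤ N) (δ : ℝ) (_ : δ ∈ Set.Ioo (0 : ℝ) 1)
      (_ : ∀ᵐ xs ∂(Measure.pi fun _ : Fin N => μ),
        IsUnit (Matrix.of fun i j : Fin N =>
          ((ρ (xs i) * ρ (xs j)).trace).re : Matrix (Fin N) (Fin N) ℝ).det),
      ENNReal.ofReal (1 - δ) ≤
        (Measure.pi fun _ : Fin N => μ)
          {xs | let K : Matrix (Fin N) (Fin N) ℝ :=
                  Matrix.of fun i j => ((ρ (xs i) * ρ (xs j)).trace).re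
                (∫ x, |clip (∑ i, ∑ j,
                    ((ρ (xs i) * ρ x).trace).re * (K⁻¹ i j) * f (xs j)) - f x| ∂μ) ≤
                  C * (Real.sqrt (min (N : ℝ) ((O' * O').trace).re / N) +
                    Real.sqrt (Real.log (1 / δ) / N))} := by
  refine ⟨5, by norm_num, ?_⟩
  intro X _ μ _ n _ ρ hρm hρ O' hO' hOn f hf N hN δ hδ hinv
  have hherm : ∀ x, (ρ x).IsHermitian := fun x => by
    obtain ⟨ψ, _, h⟩ := hρ x
    rw [h, Matrix.IsHermitian, Matrix.conjTranspose_vecMulVec, star_star]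
  have hfO : ∀ x, f x = inner ℝ (realVec O') (realVec (ρ x)) := fun x => by
    rw [hf, inner_realVec _ _ (hherm x)]
  have hK : ∀ x y, ((ρ x * ρ y).trace).re = inner ℝ (realVec (ρ x)) (realVec (ρ y)) :=
    fun x y => by rw [inner_realVec _ _ (hherm y)]
  have hnorm : ∀ x, ‖realVec (ρ x)‖ ≤ 1 := fun x => by
    have h1 : ‖realVec (ρ x)‖ ^ 2 = 1 := by
      rw [← real_inner_self_eq_norm_sq, ← hK]
      obtain ⟨ψ, h, h'⟩ := hρ x
      rw [h', Matrix.vecMulVec_mul_vecMulVec, h, one_smul, Matrix.trace_vecMulVec,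
        dotProduct_comm, h]
      simp
    nlinarith [norm_nonneg (realVec (ρ x))]
  have hmeas : ∀ v, Measurable fun x => inner ℝ v (realVec (ρ x)) := fun v => by
    simp only [realVec, PiLp.inner_apply, Fintype.sum_sum_type, Sum.elim_inl, Sum.elim_inr]
    refine Measurable.add (Finset.measurable_fun_sum _ fun p _ => ?_)
      (Finset.measurable_fun_sum _ fun p _ => ?_)
    · exact Measurable.inner measurable_const (Complex.measurable_re.comp (hρm _ _))
    · exact Measurable.inner measurable_const (Complex.measurable_im.comp (hρm _ _))
  have hO1 : ∀ x, |inner ℝ (realVec O') (realVec (ρ x))| ≤ 1 := fun x => by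
    rw [← hfO, hf]
    obtain ⟨ψ, h, h'⟩ := hρ x
    rw [h']
    exact expval_le O' hOn ψ h
  have hOsq : ((O' * O').trace).re = ‖realVec O'‖ ^ 2 := by
    rw [← real_inner_self_eq_norm_sq, inner_realVec _ _ hO']
  refine (core μ (realVec O') (fun x => realVec (ρ x)) hnorm hmeas hO1 N hN δ hδ).trans ?_
  refine measure_mono_ae ?_
  filter_upwards [hinv] with xs hxs hgood
  set K : Matrix (Fin N) (Fin N) ℝ :=
    Matrix.of fun i j => ((ρ (xs i) * ρ (xs j)).trace).re with hKdef
  obtain ⟨hA1, hA2⟩ := interp (realVec O') (fun i => realVec (ρ (xs i))) K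
    (fun i j => by rw [hKdef, Matrix.of_apply, hK]) hxs (fun i => f (xs i)) (fun i => hfO _) _ rfl
  have := hgood _ hA1 hA2
  change (∫ x, |clip (∑ i, ∑ j,
    ((ρ (xs i) * ρ x).trace).re * (K⁻¹ i j) * f (xs j)) - f x| ∂μ) ≤ _
  rw [hOsq]
  convert this using 1
  congr 1
  ext x
  rw [hfO x, sum_inner]
  congr 3
  refine Finset.sum_congr rfl fun i _ => ?_
  rw [inner_smul_left, hK]
  simp only [conj_trivial]
  rw [Finset.sum_mul]
  refine Finset.sum_congr rfl fun j _ => ?_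
  ring
end
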